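/- arXiv:math/0607439 — 4 statements merged into one kernel-verified Lean document; each statement's English description precedes it below -/
import Mathlib

section
/- Let d ≥ 1 be an integer. There exists a measurable function f : [0,1]^d → {−1,1} such that for every g ∈ F^(d), λ_d({x : f(x) ≠ g(x)}) > 0; that is, not every measurable {−1,1}-valued function on [0,1]^d is λ_d-a.e. equal to a member of F^(d). -/
open MeasureTheory Set
open scoped ENNReal

noncomputable section

/-- Points of `ℝ^d`. -/
abbrev Pt (d : ℕ) : Type := Fin d → ℝ

/-- The unit cube `[0,1]^d`. -/
def unitCube (d : ℕ) : Set (Pt d) := Set.Icc 0 1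

/-- Lebesgue measure `λ_d` on `[0,1]^d`. -/
def lamd (d : ℕ) : Measure (Pt d) := volume.restrict (unitCube d)

/-- The dyadic subinterval of `[0,1]` at level `j` with index `k`:
`[k 2^{-j}, (k+1) 2^{-j})` for `k < 2^j - 1` and `[1 - 2^{-j}, 1]` for `k = 2^j - 1`. -/
def dyadicI (j k : ℕ) : Set ℝ :=
  if k = 2 ^ j - 1 then Set.Icc (1 - ((2 : ℝ) ^ j)⁻¹) 1
  else Set.Ico ((k : ℝ) / 2 ^ j) (((k : ℝ) + 1) / 2 ^ j)

/-- The dyadic cube `I_k^{(j)} ⊆ [0,1]^d` at level `j` with multi-index `k`. -/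
def dyadicCube (d j : ℕ) (k : Fin d → ℕ) : Set (Pt d) :=
  {x | ∀ i, x i ∈ dyadicI j (k i)}

/-- `f` is represented by the (automatically countable) family `T` of pairwise disjoint
dyadic cubes whose union has full Lebesgue measure in `[0,1]^d`, with `f` constant
on each cube of the family. -/
def IsDyadicRep (d : ℕ) (f : Pt d → ℝ) (T : Set (ℕ × (Fin d → ℕ))) : Prop :=
  (∀ p ∈ T, ∀ i, p.2 i < 2 ^ p.1) ∧
  (T.PairwiseDisjoint fun p => dyadicCube d p.1 p.2) ∧
  lamd d (unitCube d \ ⋃ p ∈ T, dyadicCube d p.1 p.2) = 0 ∧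
  (∀ p ∈ T, ∀ x ∈ dyadicCube d p.1 p.2, ∀ y ∈ dyadicCube d p.1 p.2, f x = f y)

/-- The class `F^(d)` of measurable `{-1,1}`-valued functions admitting a dyadic
representation. -/
def memF (d : ℕ) (f : Pt d → ℝ) : Prop :=
  Measurable f ∧ (∀ x, f x = 1 ∨ f x = -1) ∧ ∃ T, IsDyadicRep d f T

/-- The class `F_w^(d)`: a dyadic representation with at most `w j` cubes of side
`2^{-j}` for every level `j`. -/
def memFw (d : ℕ) (w : ℕ → ℝ) (f : Pt d → ℝ) : Prop :=
  Measurable f ∧ (∀ x, f x = 1 ∨ f x = -1) ∧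
    ∃ T, IsDyadicRep d f T ∧
      ∀ j, ((T ∩ {p | p.1 = j}).encard : ℝ≥0∞) ≤ ENNReal.ofReal (w j)

/-- Marginal `P^X` of `π` on `[0,1]^d`. -/
def margX {d : ℕ} (π : Measure (Pt d × ℝ)) : Measure (Pt d) := π.map Prod.fst

/-- The labels of `π` lie in `{-1, 1}` almost surely. -/
def Labels {d : ℕ} (π : Measure (Pt d × ℝ)) : Prop := π {p | p.2 = 1 ∨ p.2 = -1} = 1

/-- `η` is the regression function (conditional probability of `Y = 1`) of `π`. -/
def IsRegression {d : ℕ} (π : Measure (Pt d × ℝ)) (η : Pt d → ℝ) : Prop :=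
  Measurable η ∧ (∀ x, η x ∈ Set.Icc (0 : ℝ) 1) ∧
    ∀ s : Set (Pt d), MeasurableSet s →
      π (s ×ˢ {(1 : ℝ)}) = ∫⁻ x in s, ENNReal.ofReal (η x) ∂(margX π)

/-- The Bayes rule `f*` associated with the regression function `η`. -/
def bayes {d : ℕ} (η : Pt d → ℝ) (x : Pt d) : ℝ := if 1 / 2 ≤ η x then 1 else -1

/-- Misclassification risk `R(f) = π({(x,y) : f(x) ≠ y})`. -/
def risk {d : ℕ} (π : Measure (Pt d × ℝ)) (f : Pt d → ℝ) : ℝ :=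
  (π {p | f p.1 ≠ p.2}).toReal

/-- Assumption (A1): `P^X` is absolutely continuous w.r.t. `λ_d` with density
between `a` and `A`. -/
def A1cond {d : ℕ} (π : Measure (Pt d × ℝ)) (a A : ℝ) : Prop :=
  ∀ s : Set (Pt d), MeasurableSet s →
    ENNReal.ofReal a * lamd d s ≤ margX π s ∧ margX π s ≤ ENNReal.ofReal A * lamd d s

/-- Strong margin assumption (SMA) with margin `h`. -/
def SMAcond {d : ℕ} (π : Measure (Pt d × ℝ)) (η : Pt d → ℝ) (h : ℝ) : Prop :=
  margX π {x | h ≤ |2 * η x - 1|} = 1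

/-- Number of indices `i` satisfying `P i`. -/
def cnt (n : ℕ) (P : Fin n → Prop) : ℕ := Nat.card {i // P i}

/-- Index of the level-`J` dyadic interval containing `t ∈ [0,1]`. -/
def dyadicIdx (J : ℕ) (t : ℝ) : ℕ := min ⌊t * 2 ^ J⌋₊ (2 ^ J - 1)

/-- The level-`J` dyadic cube containing `x ∈ [0,1]^d`. -/
def cubeOf (d J : ℕ) (x : Pt d) : Set (Pt d) := dyadicCube d J fun i => dyadicIdx J (x i)

open Classical in
/-- The dyadic majority-vote classifier `f̂_n^{(J)}` built from the sample `s`. -/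
def fhat (d J n : ℕ) (s : Fin n → Pt d × ℝ) (x : Pt d) : ℝ :=
  if (∃ i, (s i).1 ∈ cubeOf d J x) ∧
      cnt n (fun i => (s i).1 ∈ cubeOf d J x ∧ (s i).2 = -1) <
        cnt n (fun i => (s i).1 ∈ cubeOf d J x ∧ (s i).2 = 1)
  then 1 else -1

/-- The `n`-fold product measure `π^{⊗n}` governing the i.i.d. sample. -/
def sampM {d : ℕ} (π : Measure (Pt d × ℝ)) [SigmaFinite π] (n : ℕ) :
    Measure (Fin n → Pt d × ℝ) := Measure.pi fun _ => π

/-- Expected excess risk `E_{π^{⊗n}}[R(f̂_n) - R(f*)]` of the classifier `F`. -/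
def excessExp {d : ℕ} (π : Measure (Pt d × ℝ)) [SigmaFinite π] (η : Pt d → ℝ) (n : ℕ)
    (F : (Fin n → Pt d × ℝ) → Pt d → ℝ) : ℝ :=
  ∫ s, risk π (F s) ∂(sampM π n) - risk π (bayes η)

/-- The class `P_{w,h,a,A}` of probability measures (together with their regression
functions) satisfying (A1), (SMA), and whose Bayes rule belongs to `F_w^(d)`. -/
def Pclass (d : ℕ) (w : ℕ → ℝ) (h a A : ℝ) :
    Set (ProbabilityMeasure (Pt d × ℝ) × (Pt d → ℝ)) :=
  {p | Labels (p.1 : Measure (Pt d × ℝ)) ∧ IsRegression (p.1 : Measure (Pt d × ℝ)) p.2 ∧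
       A1cond (p.1 : Measure (Pt d × ℝ)) a A ∧ SMAcond (p.1 : Measure (Pt d × ℝ)) p.2 h ∧
       memFw d w (bayes p.2)}

end

/-- In positive dimension there are dense open sets of volume less than one. -/
lemma exists_isOpen_dense_volume_lt_one (d : ℕ) (hd : 1 ≤ d) :
    ∃ U : Set (Pt d), IsOpen U ∧ Dense U ∧ volume U < 1 := by
  have : Nonempty (Fin d) := ⟨⟨0, hd⟩⟩
  obtain ⟨s, hsc, hsd⟩ := TopologicalSpace.exists_countable_dense (Pt d)
  have h0 : volume s < 1 := by
    rw [hsc.measure_zero]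
    exact one_pos
  obtain ⟨U, hsU, hU, hlt⟩ := s.exists_isOpen_lt_of_lt 1 h0
  exact ⟨U, hU, hsd.mono hsU, hlt⟩

lemma volume_unitCube (d : ℕ) : volume (unitCube d) = 1 := by
  simp [unitCube, Real.volume_Icc_pi]

/-- A dyadic interval contains the open interval with the same endpoints. -/
lemma Ioo_subset_dyadicI {j k : ℕ} :
    Ioo ((k : ℝ) / 2 ^ j) (((k : ℝ) + 1) / 2 ^ j) ⊆ dyadicI j k := by
  intro x hx
  unfold dyadicI
  split_ifs with h
  · have h2 : (1 : ℝ) ≤ 2 ^ j := one_le_pow₀ one_le_two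
    have hkj : (k : ℝ) = 2 ^ j - 1 := by
      rw [h, Nat.cast_sub Nat.one_le_two_pow]
      simp
    have hl : (k : ℝ) / 2 ^ j = 1 - ((2 : ℝ) ^ j)⁻¹ := by
      rw [hkj]
      field_simp
    have hr : ((k : ℝ) + 1) / 2 ^ j = 1 := by
      rw [hkj]
      field_simp
      ring
    rw [hl, hr] at hx
    exact Ioo_subset_Icc_self hx
  · exact Ioo_subset_Ico_self hx

/-- A dyadic cube contains a nonempty open subset of the unit cube. -/
lemma exists_isOpen_subset_dyadicCube {d j : ℕ} {k : Fin d → ℕ} (hk : ∀ i, k i < 2 ^ j) :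
    ∃ V : Set (Pt d), IsOpen V ∧ V.Nonempty ∧ V ⊆ dyadicCube d j k ∧ V ⊆ unitCube d := by
  have h2 : (0 : ℝ) < 2 ^ j := by positivity
  refine ⟨univ.pi fun i => Ioo ((k i : ℝ) / 2 ^ j) (((k i : ℝ) + 1) / 2 ^ j),
    isOpen_set_pi finite_univ fun _ _ => isOpen_Ioo, ?_, ?_, ?_⟩
  · refine univ_pi_nonempty_iff.2 fun i => nonempty_Ioo.2 ?_
    gcongr
    exact lt_add_one _
  · exact fun x hx i => Ioo_subset_dyadicI (hx i (mem_univ i))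
  · intro x hx
    refine ⟨fun i => ?_, fun i => ?_⟩
    · exact le_trans (by positivity) (hx i (mem_univ i)).1.le
    · refine (hx i (mem_univ i)).2.le.trans ?_
      rw [Pi.one_apply, div_le_one h2]
      exact_mod_cast hk i

/-- Not every measurable `{-1,1}`-valued function on `[0,1]^d`
is `λ_d`-a.e. equal to a member of `F^(d)`. -/
theorem exists_not_ae_dyadic (d : ℕ) (hd : 1 ≤ d) :
    ∃ f : Pt d → ℝ, Measurable f ∧ (∀ x, f x = 1 ∨ f x = -1) ∧
      ∀ g, memF d g → 0 < lamd d {x | f x ≠ g x} := by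
  classical
  obtain ⟨U, hU, hUd, hU1⟩ := exists_isOpen_dense_volume_lt_one d hd
  refine ⟨fun x => if x ∈ U then 1 else -1,
    Measurable.ite hU.measurableSet measurable_const measurable_const, fun x => ?_, ?_⟩
  · by_cases hx : x ∈ U <;> simp [hx]
  rintro g ⟨-, -, T, hT, -, hcov, hconst⟩
  refine pos_iff_ne_zero.2 fun hnull => ?_
  have hg : ∀ p ∈ T, ∀ x ∈ dyadicCube d p.1 p.2, g x = 1 := by
    intro p hp x hx
    obtain ⟨V, hV, hVne, hVp, hVc⟩ := exists_isOpen_subset_dyadicCube (hT p hp)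
    have hpos : 0 < lamd d (V ∩ U) := by
      rw [lamd, Measure.restrict_apply (hV.inter hU).measurableSet,
        inter_eq_left.2 (inter_subset_left.trans hVc)]
      exact (hV.inter hU).measure_pos _ (hUd.inter_open_nonempty V hV hVne)
    obtain ⟨y, hy, hfg⟩ : ∃ y ∈ V ∩ U, ¬ (if y ∈ U then (1 : ℝ) else -1) ≠ g y := by
      by_contra! hcon
      exact hpos.ne' (measure_mono_null hcon hnull)
    rw [hconst p hp x hx y (hVp hy.1), ← not_not.1 hfg, if_pos hy.2]
  have hsub : unitCube d \ U ⊆ (unitCube d \ ⋃ p ∈ T, dyadicCube d p.1 p.2) ∪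
      {x | (if x ∈ U then (1 : ℝ) else -1) ≠ g x} := by
    rintro x ⟨hxc, hxU⟩
    by_cases hx : x ∈ ⋃ p ∈ T, dyadicCube d p.1 p.2
    · obtain ⟨p, hp, hxp⟩ := mem_iUnion₂.1 hx
      right
      rw [mem_ofPred_eq, if_neg hxU, hg p hp x hxp]
      norm_num
    · exact Or.inl ⟨hxc, hx⟩
  have hzero : lamd d (unitCube d \ U) = 0 :=
    measure_mono_null hsub (measure_union_null hcov hnull)
  have hm : MeasurableSet (unitCube d) := measurableSet_Icc
  rw [lamd, Measure.restrict_apply (hm.diff hU.measurableSet),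
    inter_eq_left.2 sdiff_subset] at hzero
  have hle : volume (unitCube d) ≤ volume U := by
    calc volume (unitCube d) ≤ volume (unitCube d \ U ∪ U) :=
          measure_mono (by simp)
      _ ≤ volume (unitCube d \ U) + volume U := measure_union_le _ _
      _ = volume U := by rw [hzero, zero_add]
  rw [volume_unitCube] at hle
  exact hU1.not_ge hle
end

section
/- Let d ≥ 1 be an integer and let η : [0,1]^d → [0,1] be a function. Define f_η(x) = 1 if η(x) ≥ 1/2 and f_η(x) = −1 otherwise. If both sets {x : η(x) ≥ 1/2} and {x : η(x) < 1/2} are almost everywhere open (each differs from an open subset of [0,1]^d by a λ_d-null set), then there exists g ∈ F^(d) such that g(x) = f_η(x) for λ_d-almost every x ∈ [0,1]^d. -/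
open MeasureTheory Set
open scoped ENNReal

/-- Membership of `t` in a dyadic interval, in terms of the dyadic index of `t`. -/
lemma mem_dyadicI_iff {j k : ℕ} (hk : k < 2 ^ j) (t : ℝ) :
    t ∈ dyadicI j k ↔ (0 ≤ t ∧ t ≤ 1) ∧ dyadicIdx j t = k := by
  have hpos : (0 : ℝ) < 2 ^ j := by positivity
  have hone : 1 ≤ 2 ^ j := Nat.one_le_two_pow
  have hcast : ((2 ^ j - 1 : ℕ) : ℝ) = 2 ^ j - 1 := by push_cast [Nat.cast_sub hone]; rfl
  unfold dyadicI dyadicIdx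
  split_ifs with h
  · subst h
    rw [min_eq_right_iff, Set.mem_Icc]
    constructor
    · rintro ⟨h0, h1⟩
      have hinv : ((2 : ℝ) ^ j)⁻¹ ≤ 1 := inv_le_one_of_one_le₀ (by exact_mod_cast hone)
      refine ⟨⟨by linarith, h1⟩, Nat.le_floor ?_⟩
      rw [hcast]
      have := mul_le_mul_of_nonneg_right h0 hpos.le
      rwa [sub_mul, inv_mul_cancel₀ hpos.ne', one_mul] at this
    · rintro ⟨⟨h0, h1⟩, h2⟩
      refine ⟨?_, h1⟩
      have h3 := (Nat.le_floor_iff (by positivity)).1 h2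
      rw [hcast] at h3
      refine le_of_mul_le_mul_right ?_ hpos
      rwa [sub_mul, inv_mul_cancel₀ hpos.ne', one_mul]
  · have hk' : k < 2 ^ j - 1 := by omega
    have hkc : (k : ℝ) + 1 ≤ 2 ^ j := by exact_mod_cast hk
    have key : min ⌊t * 2 ^ j⌋₊ (2 ^ j - 1) = k ↔ ⌊t * 2 ^ j⌋₊ = k := by omega
    rw [key, Set.mem_Ico, div_le_iff₀ hpos, lt_div_iff₀ hpos]
    constructor
    · rintro ⟨h0, h1⟩
      have ht : 0 ≤ t * 2 ^ j := le_trans (Nat.cast_nonneg k) h0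
      refine ⟨⟨nonneg_of_mul_nonneg_left ht hpos, ?_⟩, (Nat.floor_eq_iff ht).2 ⟨h0, h1⟩⟩
      refine le_of_mul_le_mul_right ?_ hpos
      linarith
    · rintro ⟨⟨h0, -⟩, h2⟩
      exact (Nat.floor_eq_iff (by positivity)).1 h2

lemma dyadicIdx_lt (j : ℕ) (t : ℝ) : dyadicIdx j t < 2 ^ j := by
  have hone : 1 ≤ 2 ^ j := Nat.one_le_two_pow
  unfold dyadicIdx
  omega

/-- The dyadic index at a coarser level is the quotient of the one at a finer level. -/
lemma dyadicIdx_eq_div {i j : ℕ} (hij : i ≤ j) (t : ℝ) :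
    dyadicIdx i t = dyadicIdx j t / 2 ^ (j - i) := by
  obtain ⟨e, rfl⟩ := Nat.exists_eq_add_of_le hij
  have hmono : Monotone fun n : ℕ => n / 2 ^ e := fun a b h => Nat.div_le_div_right h
  have hfloor : ⌊t * 2 ^ i⌋₊ = ⌊t * 2 ^ (i + e)⌋₊ / 2 ^ e := by
    rw [← Nat.floor_div_natCast]
    congr 1
    push_cast
    rw [pow_add]
    field_simp
  have hlast : 2 ^ i - 1 = (2 ^ (i + e) - 1) / 2 ^ e := by
    have hi : 1 ≤ 2 ^ i := Nat.one_le_two_pow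
    have he : 1 ≤ 2 ^ e := Nat.one_le_two_pow
    obtain ⟨a, ha⟩ := Nat.exists_eq_add_of_le' hi
    symm
    rw [Nat.div_eq_iff he, pow_add, ha, Nat.add_sub_cancel, add_mul]
    omega
  unfold dyadicIdx
  rw [Nat.add_sub_cancel_left, hfloor, hlast]
  exact (hmono.map_min).symm

lemma abs_sub_le_of_mem_dyadicI {j k : ℕ} {s t : ℝ} (hs : s ∈ dyadicI j k)
    (ht : t ∈ dyadicI j k) : |s - t| ≤ ((2 : ℝ) ^ j)⁻¹ := by
  unfold dyadicI at hs ht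
  split_ifs at hs ht with h
  · rw [abs_le]
    constructor <;> linarith [hs.1, hs.2, ht.1, ht.2]
  · rw [Set.mem_Ico, add_div, one_div] at hs ht
    rw [abs_le]
    constructor <;> linarith [hs.1, hs.2, ht.1, ht.2]

lemma measurableSet_dyadicCube (d j : ℕ) (k : Fin d → ℕ) : MeasurableSet (dyadicCube d j k) := by
  have hI : ∀ k, MeasurableSet (dyadicI j k) := fun k => by
    unfold dyadicI
    split_ifs
    exacts [measurableSet_Icc, measurableSet_Ico]
  have : dyadicCube d j k = ⋂ i, (fun x : Pt d => x i) ⁻¹' dyadicI j (k i) := by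
    ext x
    simp [dyadicCube]
  rw [this]
  exact MeasurableSet.iInter fun i => measurable_pi_apply i (hI _)

lemma mem_dyadicCube_iff {d j : ℕ} {k : Fin d → ℕ} (hk : ∀ i, k i < 2 ^ j) (x : Pt d) :
    x ∈ dyadicCube d j k ↔ x ∈ unitCube d ∧ (fun i => dyadicIdx j (x i)) = k := by
  simp only [dyadicCube, unitCube, Set.mem_ofPred_eq, Set.mem_Icc, Pi.le_def, funext_iff,
    ← forall_and]
  exact forall_congr' fun i => mem_dyadicI_iff (hk i) (x i)

lemma mem_cubeOf {d : ℕ} (j : ℕ) {x : Pt d} (hx : x ∈ unitCube d) : x ∈ cubeOf d j x :=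
  (mem_dyadicCube_iff (fun i => dyadicIdx_lt j (x i)) x).2 ⟨hx, rfl⟩

/-- Every point of the unit cube in an open set has a dyadic cube around it inside this set. -/
lemma exists_cubeOf_subset {d : ℕ} {O : Set (Pt d)} (hO : IsOpen O) {x : Pt d}
    (hx : x ∈ unitCube d) (hxO : x ∈ O) : ∃ j, cubeOf d j x ⊆ O := by
  obtain ⟨ε, hε, hball⟩ := Metric.isOpen_iff.1 hO x hxO
  obtain ⟨j, hj⟩ := exists_pow_lt_of_lt_one hε (by norm_num : (2 : ℝ)⁻¹ < 1)
  refine ⟨j, fun y hy => hball ?_⟩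
  rw [Metric.mem_ball, dist_pi_lt_iff hε]
  intro i
  rw [inv_pow] at hj
  exact (abs_sub_le_of_mem_dyadicI (hy i) (mem_cubeOf j hx i)).trans_lt hj

/-- The maximal dyadic cubes among those satisfying `G`. -/
def maximalCubes (d : ℕ) (G : Set (Pt d) → Prop) : Set (ℕ × (Fin d → ℕ)) :=
  {p | (∀ i, p.2 i < 2 ^ p.1) ∧ G (dyadicCube d p.1 p.2) ∧
    ∀ x ∈ dyadicCube d p.1 p.2, ∀ i < p.1, ¬ G (cubeOf d i x)}

lemma eq_of_mem_maximalCubes {d : ℕ} {G : Set (Pt d) → Prop} {p q : ℕ × (Fin d → ℕ)}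
    (hp : p ∈ maximalCubes d G) (hq : q ∈ maximalCubes d G) {x : Pt d}
    (hxp : x ∈ dyadicCube d p.1 p.2) (hxq : x ∈ dyadicCube d q.1 q.2) : p = q := by
  obtain ⟨j, k⟩ := p
  obtain ⟨j', k'⟩ := q
  obtain ⟨hk, hG, hmin⟩ := hp
  obtain ⟨hk', hG', hmin'⟩ := hq
  have h := ((mem_dyadicCube_iff hk x).1 hxp).2
  have h' := ((mem_dyadicCube_iff hk' x).1 hxq).2
  dsimp only at *
  rcases lt_trichotomy j j' with hlt | heq | hlt
  · exact absurd (show G (cubeOf d j x) by rwa [cubeOf, h]) (hmin' x hxq j hlt)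
  · subst heq
    rw [← h, ← h']
  · exact absurd (show G (cubeOf d j' x) by rwa [cubeOf, h']) (hmin x hxp j' hlt)

lemma exists_mem_maximalCubes {d : ℕ} {G : Set (Pt d) → Prop} {x : Pt d}
    (hx : x ∈ unitCube d) (hG : ∃ j, G (cubeOf d j x)) :
    ∃ p ∈ maximalCubes d G, x ∈ dyadicCube d p.1 p.2 := by
  classical
  refine ⟨(Nat.find hG, fun i => dyadicIdx (Nat.find hG) (x i)),
    ⟨fun i => dyadicIdx_lt _ _, Nat.find_spec hG, ?_⟩, mem_cubeOf _ hx⟩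
  intro y hy i hi
  have hidx := ((mem_dyadicCube_iff (fun i => dyadicIdx_lt _ _) y).1 hy).2
  have : cubeOf d i y = cubeOf d i x := by
    unfold cubeOf
    congr 1
    funext l
    rw [dyadicIdx_eq_div hi.le (y l), dyadicIdx_eq_div hi.le (x l), congrFun hidx l]
  rw [this]
  exact Nat.find_min hG hi

/-- If `{η ≥ 1/2}` and `{η < 1/2}` are almost everywhere open,
then the plug-in rule `f_η` is `λ_d`-a.e. equal to a member of `F^(d)`. -/
theorem ae_open_level_sets_implies_dyadic (d : ℕ) (hd : 1 ≤ d) (η : Pt d → ℝ)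
    (hη : ∀ x, η x ∈ Set.Icc (0 : ℝ) 1)
    (h1 : ∃ O : Set (Pt d), IsOpen O ∧ lamd d (symmDiff {x | 1 / 2 ≤ η x} O) = 0)
    (h2 : ∃ O : Set (Pt d), IsOpen O ∧ lamd d (symmDiff {x | η x < 1 / 2} O) = 0) :
    ∃ g, memF d g ∧ ∀ᵐ x ∂(lamd d), g x = bayes η x := by
  classical
  obtain ⟨U, hU, hUη⟩ := h1
  obtain ⟨V, hV, hVη⟩ := h2
  rw [measure_eq_zero_iff_ae_notMem] at hUη hVη
  have hcube : ∀ᵐ x ∂(lamd d), x ∈ unitCube d := ae_restrict_mem measurableSet_Icc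
  let T := maximalCubes d fun s => s ⊆ U ∨ s ⊆ V
  let A : Set (Pt d) := ⋃ p ∈ T ∩ {p | dyadicCube d p.1 p.2 ⊆ U}, dyadicCube d p.1 p.2
  have hA : MeasurableSet A :=
    MeasurableSet.biUnion (Set.to_countable _) fun p _ => measurableSet_dyadicCube d p.1 p.2
  have hAmem : ∀ p ∈ T, ∀ x ∈ dyadicCube d p.1 p.2, x ∈ A ↔ dyadicCube d p.1 p.2 ⊆ U := by
    intro p hp x hx
    refine ⟨fun h => ?_, fun h => Set.mem_biUnion ⟨hp, h⟩ hx⟩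
    obtain ⟨q, ⟨hq, hqU⟩, hxq⟩ := Set.mem_iUnion₂.1 h
    rwa [eq_of_mem_maximalCubes hp hq hx hxq]
  have hcover : ∀ᵐ x ∂(lamd d), ∃ p ∈ T, x ∈ dyadicCube d p.1 p.2 := by
    filter_upwards [hUη, hVη, hcube] with x hxU hxV hx
    apply exists_mem_maximalCubes hx
    rcases le_or_gt (1 / 2) (η x) with h | h
    · have hxO : x ∈ U := by
        by_contra hn
        exact hxU (Or.inl ⟨h, hn⟩)
      exact (exists_cubeOf_subset hU hx hxO).imp fun _ => Or.inl
    · have hxO : x ∈ V := by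
        by_contra hn
        exact hxV (Or.inl ⟨h, hn⟩)
      exact (exists_cubeOf_subset hV hx hxO).imp fun _ => Or.inr
  refine ⟨fun x => if x ∈ A then 1 else -1, ⟨?_, ?_, T, ?_, ?_, ?_, ?_⟩, ?_⟩
  · exact Measurable.ite hA measurable_const measurable_const
  · intro x
    dsimp only
    split_ifs <;> simp
  · exact fun p hp => hp.1
  · intro p hp q hq hpq
    exact Set.disjoint_left.2 fun x hxp hxq => hpq (eq_of_mem_maximalCubes hp hq hxp hxq)
  · rw [measure_eq_zero_iff_ae_notMem]
    filter_upwards [hcover] with x hx hmem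
    obtain ⟨p, hp, hxp⟩ := hx
    exact hmem.2 (Set.mem_biUnion hp hxp)
  · intro p hp x hx y hy
    simp only [hAmem p hp x hx, hAmem p hp y hy]
  · filter_upwards [hUη, hVη, hcover] with x hxU hxV ⟨p, hp, hxp⟩
    simp only [hAmem p hp x hxp, bayes]
    by_cases hpU : dyadicCube d p.1 p.2 ⊆ U
    · have : 1 / 2 ≤ η x := by
        by_contra hn
        exact hxU (Or.inr ⟨hpU hxp, hn⟩)
      rw [if_pos hpU, if_pos this]
    · have hpV : dyadicCube d p.1 p.2 ⊆ V := hp.2.1.resolve_left hpU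
      have : ¬ 1 / 2 ≤ η x := by
        rw [not_le]
        by_contra hn
        exact hxV (Or.inr ⟨hpV hxp, hn⟩)
      rw [if_neg hpU, if_neg this]
end

section
/- (Approximation Theorem) Let d ≥ 1 be an integer, A ≥ 1, and let w : ℕ → [0,∞) satisfy ∑_{j=0}^∞ 2^{−dj}·⌊w(j)⌋ < ∞. Let ε > 0 and let J be any nonnegative integer with ∑_{j=J+1}^∞ 2^{−dj}·⌊w(j)⌋ < ε/A. Then for every probability measure π on [0,1]^d × {−1,1} whose marginal P^X is absolutely continuous with dP^X/dλ_d ≤ A λ_d-a.e. and whose Bayes rule f* belongs to F_w^(d), there exists a function g : [0,1]^d → {−1,1} that is constant on each dyadic cube of level J such that R(g) − R(f*) ≤ ε; moreover g can be chosen with λ_d({x : g(x) ≠ f*(x)}) ≤ 2 ∑_{j=J+1}^∞ 2^{−dj}·⌊w(j)⌋. -/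
open MeasureTheory Set
open scoped ENNReal

lemma measurable_dyadicIdx (J : ℕ) : Measurable (dyadicIdx J) :=
  (Nat.measurable_floor.comp (measurable_id.mul_const _)).min measurable_const

/-- Lower corner of the level-`J` dyadic cube containing `x`. -/
noncomputable def dyadicCorner (d J : ℕ) (x : Pt d) : Pt d :=
  fun i => (dyadicIdx J (x i) : ℝ) / 2 ^ J

lemma measurable_dyadicCorner (d J : ℕ) : Measurable (dyadicCorner d J) :=
  measurable_pi_lambda _ fun i =>
    ((measurable_from_top (f := fun n : ℕ => (n : ℝ))).comp
      ((measurable_dyadicIdx J).comp (measurable_pi_apply i))).div_const _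

lemma dyadicIdx_eq_of_mem {J k : ℕ} (hk : k < 2 ^ J) {t : ℝ} (ht : t ∈ dyadicI J k) :
    dyadicIdx J t = k := by
  have hpos : (0 : ℝ) < 2 ^ J := by positivity
  have h1 : 1 ≤ 2 ^ J := Nat.one_le_two_pow
  unfold dyadicI at ht
  unfold dyadicIdx
  split_ifs at ht with h
  · subst h
    refine min_eq_right (Nat.le_floor ?_)
    have := mul_le_mul_of_nonneg_right ht.1 hpos.le
    rw [sub_mul, inv_mul_cancel₀ hpos.ne'] at this
    push_cast [Nat.cast_sub h1]
    linarith
  · obtain ⟨hl, hr⟩ := ht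
    rw [div_le_iff₀ hpos] at hl
    rw [lt_div_iff₀ hpos] at hr
    have hfl : ⌊t * 2 ^ J⌋₊ = k :=
      (Nat.floor_eq_iff ((Nat.cast_nonneg k).trans hl)).2 ⟨hl, hr⟩
    rw [hfl]
    omega

/-- The lower endpoint of the level-`J` dyadic interval containing `t` stays in every coarser
dyadic interval containing `t`. -/
lemma dyadicIdx_div_mem {j J k : ℕ} (hjJ : j ≤ J) (hk : k < 2 ^ j) {t : ℝ}
    (ht : t ∈ dyadicI j k) : (dyadicIdx J t : ℝ) / 2 ^ J ∈ dyadicI j k := by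
  obtain ⟨n, rfl⟩ := Nat.exists_eq_add_of_le hjJ
  have hpos : (0 : ℝ) < 2 ^ (j + n) := by positivity
  have hj : (0 : ℝ) < 2 ^ j := by positivity
  have hn : (0 : ℝ) < 2 ^ n := by positivity
  have h1n : 1 ≤ 2 ^ n := Nat.one_le_two_pow
  have hle : 2 ^ n ≤ 2 ^ (j + n) := Nat.pow_le_pow_right (by norm_num) (by omega)
  have h1 : 1 ≤ 2 ^ (j + n) := Nat.one_le_two_pow
  unfold dyadicI at ht ⊢
  split_ifs at ht ⊢ with h
  · have hinv : ((2 : ℝ) ^ j)⁻¹ * 2 ^ (j + n) = 2 ^ n := by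
      rw [pow_add]; field_simp
    have hlow : 2 ^ (j + n) - 2 ^ n ≤ dyadicIdx (j + n) t := by
      refine le_min (Nat.le_floor ?_) (by omega)
      have := mul_le_mul_of_nonneg_right ht.1 hpos.le
      rw [sub_mul, hinv] at this
      push_cast [Nat.cast_sub hle]
      linarith
    have hup : dyadicIdx (j + n) t ≤ 2 ^ (j + n) := (min_le_right _ _).trans (Nat.sub_le _ _)
    have hlow' : (2 : ℝ) ^ (j + n) - 2 ^ n ≤ dyadicIdx (j + n) t := by
      have := (Nat.cast_le (α := ℝ)).2 hlow
      push_cast [Nat.cast_sub hle] at this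
      exact this
    constructor
    · rw [le_div_iff₀ hpos, sub_mul, hinv, one_mul]
      exact hlow'
    · rw [div_le_one hpos]
      exact_mod_cast hup
  · obtain ⟨hl, hr⟩ := ht
    rw [div_le_iff₀ hj] at hl
    rw [lt_div_iff₀ hj] at hr
    have hlow : k * 2 ^ n ≤ ⌊t * 2 ^ (j + n)⌋₊ := by
      apply Nat.le_floor
      push_cast
      rw [pow_add, ← mul_assoc]
      exact mul_le_mul_of_nonneg_right hl hn.le
    have hup : ⌊t * 2 ^ (j + n)⌋₊ < (k + 1) * 2 ^ n := by
      rw [Nat.floor_lt' (by positivity)]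
      push_cast
      rw [pow_add, ← mul_assoc]
      exact mul_lt_mul_of_pos_right hr hn
    have hmul : (k + 1) * 2 ^ n ≤ 2 ^ (j + n) := by
      rw [pow_add]
      exact Nat.mul_le_mul_right _ hk
    have hidx : dyadicIdx (j + n) t = ⌊t * 2 ^ (j + n)⌋₊ := min_eq_left (by omega)
    rw [← hidx] at hlow hup
    have hlow' : (k : ℝ) * 2 ^ n ≤ dyadicIdx (j + n) t := by exact_mod_cast hlow
    have hup' : (dyadicIdx (j + n) t : ℝ) < (k + 1) * 2 ^ n := by exact_mod_cast hup
    constructor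
    · rw [div_le_div_iff₀ hj hpos, pow_add]
      nlinarith
    · rw [div_lt_div_iff₀ hpos hj, pow_add]
      nlinarith

lemma dyadicCorner_mem {d j J : ℕ} (hjJ : j ≤ J) {k : Fin d → ℕ} (hk : ∀ i, k i < 2 ^ j)
    {x : Pt d} (hx : x ∈ dyadicCube d j k) : dyadicCorner d J x ∈ dyadicCube d j k :=
  fun i => dyadicIdx_div_mem hjJ (hk i) (hx i)

lemma dyadicCorner_eq_of_mem {d J : ℕ} {k : Fin d → ℕ} (hk : ∀ i, k i < 2 ^ J) {x y : Pt d}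
    (hx : x ∈ dyadicCube d J k) (hy : y ∈ dyadicCube d J k) :
    dyadicCorner d J x = dyadicCorner d J y := by
  ext i
  simp only [dyadicCorner, dyadicIdx_eq_of_mem (hk i) (hx i), dyadicIdx_eq_of_mem (hk i) (hy i)]

lemma volume_dyadicI (j k : ℕ) : volume (dyadicI j k) = ((2 : ℝ≥0∞) ^ j)⁻¹ := by
  have hlen : volume (dyadicI j k) = ENNReal.ofReal ((2 : ℝ) ^ j)⁻¹ := by
    unfold dyadicI
    split_ifs
    · rw [Real.volume_Icc]
      congr 1
      ring
    · rw [Real.volume_Ico]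
      congr 1
      ring
  rw [hlen, ENNReal.ofReal_inv_of_pos (by positivity), ENNReal.ofReal_pow (by norm_num)]
  norm_num

lemma volume_dyadicCube (d j : ℕ) (k : Fin d → ℕ) :
    volume (dyadicCube d j k) = ((2 : ℝ≥0∞) ^ (d * j))⁻¹ := by
  have hpi : dyadicCube d j k = Set.pi univ fun i => dyadicI j (k i) := by
    ext x
    simp [dyadicCube]
  rw [hpi, volume_pi_pi]
  simp only [volume_dyadicI, Finset.prod_const, Finset.card_univ, Fintype.card_fin]
  rw [ENNReal.inv_pow, ← pow_mul, mul_comm, ENNReal.inv_pow]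

lemma lamd_dyadicCube_le (d j : ℕ) (k : Fin d → ℕ) :
    lamd d (dyadicCube d j k) ≤ ((2 : ℝ≥0∞) ^ (d * j))⁻¹ :=
  (Measure.restrict_apply_le _ _).trans (volume_dyadicCube d j k).le

/-- The cubes of level `j` in a family with at most `c` of them cover at most `2^{-dj} ⌊c⌋`. -/
lemma lamd_biUnion_level_le (d j : ℕ) (T : Set (ℕ × (Fin d → ℕ))) (c : ℝ) (hc : 0 ≤ c)
    (hT : ((T ∩ {p | p.1 = j}).encard : ℝ≥0∞) ≤ ENNReal.ofReal c) :
    lamd d (⋃ p ∈ T ∩ {p | p.1 = j}, dyadicCube d p.1 p.2) ≤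
      ((2 : ℝ≥0∞) ^ (d * j))⁻¹ * (⌊c⌋₊ : ℝ≥0∞) := by
  set S := T ∩ {p : ℕ × (Fin d → ℕ) | p.1 = j}
  have hfin : S.Finite := by
    rw [← Set.encard_ne_top_iff]
    intro h
    rw [h] at hT
    exact absurd hT (by simp)
  have hcard : hfin.toFinset.card ≤ ⌊c⌋₊ := by
    rw [hfin.encard_eq_coe_toFinset_card] at hT
    refine Nat.le_floor ?_
    have hT' : ((hfin.toFinset.card : ℕ) : ℝ≥0∞) ≤ ENNReal.ofReal c := by simpa using hT
    rw [← ENNReal.ofReal_natCast] at hT'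
    exact (ENNReal.ofReal_le_ofReal_iff hc).1 hT'
  calc lamd d (⋃ p ∈ S, dyadicCube d p.1 p.2)
      = lamd d (⋃ p ∈ hfin.toFinset, dyadicCube d p.1 p.2) := by simp
    _ ≤ ∑ p ∈ hfin.toFinset, lamd d (dyadicCube d p.1 p.2) := measure_biUnion_finset_le _ _
    _ ≤ ∑ _p ∈ hfin.toFinset, ((2 : ℝ≥0∞) ^ (d * j))⁻¹ := by
        refine Finset.sum_le_sum fun p hp => ?_
        have hpj : p.1 = j := ((hfin.mem_toFinset).1 hp).2
        rw [← hpj]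
        exact lamd_dyadicCube_le d p.1 p.2
    _ = ((2 : ℝ≥0∞) ^ (d * j))⁻¹ * (hfin.toFinset.card : ℝ≥0∞) := by
        rw [Finset.sum_const, nsmul_eq_mul, mul_comm]
    _ ≤ _ := by gcongr

/-- Evaluating `f` at level-`J` corners changes it only on cubes of level above `J`. -/
lemma lamd_dyadicCorner_ne_le {d : ℕ} {w : ℕ → ℝ} (hw : ∀ j, 0 ≤ w j) {f : Pt d → ℝ}
    (hf : memFw d w f) (J : ℕ) :
    lamd d {x | f (dyadicCorner d J x) ≠ f x} ≤
      ∑' j : ℕ, ((2 : ℝ≥0∞) ^ (d * (j + J + 1)))⁻¹ * (⌊w (j + J + 1)⌋₊ : ℝ≥0∞) := by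
  obtain ⟨-, -, T, ⟨hlt, -, hcov, hconst⟩, hcount⟩ := hf
  have hout : lamd d (unitCube d)ᶜ = 0 := by
    rw [lamd, unitCube, Measure.restrict_apply' measurableSet_Icc]
    simp
  have hsub : {x | f (dyadicCorner d J x) ≠ f x} ⊆
      ((unitCube d)ᶜ ∪ (unitCube d \ ⋃ p ∈ T, dyadicCube d p.1 p.2)) ∪
        ⋃ j : ℕ, ⋃ p ∈ T ∩ {p | p.1 = j + J + 1}, dyadicCube d p.1 p.2 := by
    intro x hx
    by_cases hxU : x ∈ unitCube d
    · by_cases hxT : x ∈ ⋃ p ∈ T, dyadicCube d p.1 p.2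
      · right
        simp only [mem_iUnion, exists_prop] at hxT ⊢
        obtain ⟨p, hp, hxp⟩ := hxT
        have hJ : J < p.1 := by
          by_contra! hle
          exact hx (hconst p hp _ (dyadicCorner_mem hle (hlt p hp) hxp) x hxp)
        exact ⟨p.1 - J - 1, p, ⟨hp, show p.1 = _ by omega⟩, hxp⟩
      · exact Or.inl (Or.inr ⟨hxU, hxT⟩)
    · exact Or.inl (Or.inl hxU)
  calc lamd d {x | f (dyadicCorner d J x) ≠ f x}
      ≤ _ := measure_mono hsub
    _ ≤ _ := measure_union_le _ _
    _ = lamd d (⋃ j : ℕ, ⋃ p ∈ T ∩ {p | p.1 = j + J + 1}, dyadicCube d p.1 p.2) := by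
        rw [measure_union_null hout hcov, zero_add]
    _ ≤ _ := measure_iUnion_le _
    _ ≤ _ := ENNReal.tsum_le_tsum fun j => lamd_biUnion_level_le d _ T _ (hw _) (hcount _)

/-- The risks of two rules differ by at most the marginal mass of their disagreement. -/
lemma risk_sub_risk_le {d : ℕ} (π : Measure (Pt d × ℝ)) [IsProbabilityMeasure π]
    {f g : Pt d → ℝ} (hf : Measurable f) (hg : Measurable g) {ε : ℝ} (hε : 0 ≤ ε)
    (hfg : margX π {x | g x ≠ f x} ≤ ENNReal.ofReal ε) : risk π g - risk π f ≤ ε := by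
  have hmeas : MeasurableSet {x | g x ≠ f x} := (measurableSet_eq_fun hg hf).compl
  rw [margX, Measure.map_apply measurable_fst hmeas] at hfg
  have hsub : {p : Pt d × ℝ | g p.1 ≠ p.2} ⊆
      {p | f p.1 ≠ p.2} ∪ Prod.fst ⁻¹' {x | g x ≠ f x} := by
    intro p hp
    by_cases h : f p.1 = p.2
    · exact Or.inr fun h' => hp (h'.trans h)
    · exact Or.inl h
  have hle : π {p | g p.1 ≠ p.2} ≤ π {p | f p.1 ≠ p.2} + ENNReal.ofReal ε :=
    (measure_mono hsub).trans ((measure_union_le _ _).trans (by gcongr))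
  have := ENNReal.toReal_mono (by finiteness) hle
  rw [ENNReal.toReal_add (by finiteness) (by finiteness), ENNReal.toReal_ofReal hε] at this
  unfold risk
  linarith

/-- **Approximation Theorem.** If the Bayes rule belongs to the
`L¹`-ball `F_w^(d)` and the marginal density is bounded by `A`, then for any
level `J` with `∑_{j>J} 2^{-dj}⌊w(j)⌋ < ε/A` there is a `{-1,1}`-valued function,
constant on each level-`J` dyadic cube, whose excess risk is at most `ε`, and whose
disagreement with `f*` has Lebesgue measure at most `2∑_{j>J} 2^{-dj}⌊w(j)⌋`. -/
theorem approximation_theorem (d : ℕ) (hd : 1 ≤ d) (A : ℝ) (hA : 1 ≤ A)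
    (w : ℕ → ℝ) (hw : ∀ j, 0 ≤ w j)
    (hsum : ∑' j : ℕ, ((2 : ℝ≥0∞) ^ (d * j))⁻¹ * (⌊w j⌋₊ : ℝ≥0∞) < ⊤)
    (ε : ℝ) (hε : 0 < ε) (J : ℕ)
    (hJ : ∑' j : ℕ, ((2 : ℝ≥0∞) ^ (d * (j + J + 1)))⁻¹ * (⌊w (j + J + 1)⌋₊ : ℝ≥0∞) <
      ENNReal.ofReal (ε / A))
    (π : Measure (Pt d × ℝ)) [IsProbabilityMeasure π] (hL : Labels π)
    (η : Pt d → ℝ) (hη : IsRegression π η)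
    (hAbound : ∀ s : Set (Pt d), MeasurableSet s → margX π s ≤ ENNReal.ofReal A * lamd d s)
    (hb : memFw d w (bayes η)) :
    ∃ g : Pt d → ℝ, Measurable g ∧ (∀ x, g x = 1 ∨ g x = -1) ∧
      (∀ k : Fin d → ℕ, (∀ i, k i < 2 ^ J) →
        ∀ x ∈ dyadicCube d J k, ∀ y ∈ dyadicCube d J k, g x = g y) ∧
      risk π g - risk π (bayes η) ≤ ε ∧
      lamd d {x | g x ≠ bayes η x} ≤
        2 * ∑' j : ℕ, ((2 : ℝ≥0∞) ^ (d * (j + J + 1)))⁻¹ * (⌊w (j + J + 1)⌋₊ : ℝ≥0∞) := by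
  have hfm := hb.1
  have hgm : Measurable fun x => bayes η (dyadicCorner d J x) :=
    hfm.comp (measurable_dyadicCorner d J)
  have hdis := lamd_dyadicCorner_ne_le hw hb J
  refine ⟨fun x => bayes η (dyadicCorner d J x), hgm, fun x => hb.2.1 _,
    fun k hk x hx y hy => congrArg (bayes η) (dyadicCorner_eq_of_mem hk hx hy), ?_,
    hdis.trans (le_mul_of_one_le_left' one_le_two)⟩
  refine risk_sub_risk_le π hfm hgm hε.le ?_
  have hA0 : 0 < A := by linarith
  calc margX π {x | bayes η (dyadicCorner d J x) ≠ bayes η x}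
      ≤ ENNReal.ofReal A * lamd d {x | bayes η (dyadicCorner d J x) ≠ bayes η x} :=
        hAbound _ (measurableSet_eq_fun hgm hfm).compl
    _ ≤ ENNReal.ofReal A * ENNReal.ofReal (ε / A) := by
        gcongr
        exact hdis.trans hJ.le
    _ = ENNReal.ofReal ε := by
        rw [← ENNReal.ofReal_mul hA0.le, mul_div_cancel₀ _ hA0.ne']
end

section
/- Let π be a probability measure on [0,1]^d × {−1,1} with marginal P^X, let (X_1,Y_1),…,(X_n,Y_n) be i.i.d. with distribution π, and let I ⊆ [0,1]^d be measurable with q := P^X(I) > 0 and p := π(I × {1})/q > 1/2. Then the probability that #{i ≤ n : X_i ∈ I, Y_i = 1} ≤ #{i ≤ n : X_i ∈ I, Y_i = −1} is at most (1 − q·(1 − exp(−2(p − 1/2)²)))^n. -/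
open MeasureTheory Set
open scoped ENNReal

/-- The infimum over `x` of `p / x + (1 - p) x` is `2 √(p (1 - p))`, which is at most
`exp (-2 (p - 1/2)²)`; it is attained unless `p = 1`. -/
theorem exists_one_le_div_add_mul_le_exp {p : ℝ} (hp : 1 / 2 < p) (hp1 : p ≤ 1) :
    ∃ x : ℝ, 1 ≤ x ∧ x⁻¹ * p + x * (1 - p) ≤ Real.exp (-2 * (p - 1 / 2) ^ 2) := by
  rcases hp1.eq_or_lt with rfl | hp1
  · refine ⟨Real.exp (1 / 2), Real.one_le_exp (by norm_num), ?_⟩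
    rw [← Real.exp_neg]
    norm_num
  · have hr : 0 < 1 - p := by linarith
    have hp0 : 0 < p := by linarith
    refine ⟨√p / √(1 - p), ?_, ?_⟩
    · rw [one_le_div (Real.sqrt_pos.2 hr)]
      exact Real.sqrt_le_sqrt (by linarith)
    · have hx : (√p / √(1 - p))⁻¹ * p + √p / √(1 - p) * (1 - p) = 2 * (√p * √(1 - p)) := by
        have h1 : √p ≠ 0 := (Real.sqrt_pos.2 hp0).ne'
        have h2 : √(1 - p) ≠ 0 := (Real.sqrt_pos.2 hr).ne'
        have h3 : √p ^ 2 = p := Real.sq_sqrt hp0.le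
        have h4 : √(1 - p) ^ 2 = 1 - p := Real.sq_sqrt hr.le
        field_simp
        rw [h3, h4]
        ring
      rw [hx]
      refine le_of_sq_le_sq ?_ (Real.exp_pos _).le
      rw [← Real.exp_nat_mul, mul_pow, mul_pow, Real.sq_sqrt hp0.le, Real.sq_sqrt hr.le]
      have h := Real.add_one_le_exp (((2 : ℕ) : ℝ) * (-2 * (p - 1 / 2) ^ 2))
      push_cast at h ⊢
      nlinarith

/-- A product of weights, at most one where `P` holds and at least one where it fails,
compares the number of occurrences of `P` and `Q`. -/
theorem one_le_prod_of_cnt_le {n : ℕ} {P Q : Fin n → Prop} {f : Fin n → ℝ≥0∞} {x : ℝ≥0∞}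
    (hx : 1 ≤ x) (hxt : x ≠ ∞) (hP : ∀ i, P i → x⁻¹ ≤ f i) (hQ : ∀ i, Q i → x ≤ f i)
    (h1 : ∀ i, ¬ P i → 1 ≤ f i) (hPQ : ∀ i, P i → ¬ Q i) (h : cnt n P ≤ cnt n Q) :
    1 ≤ ∏ i, f i := by
  classical
  have hx0 : x ≠ 0 := (zero_lt_one.trans_le hx).ne'
  have hcard (R : Fin n → Prop) (y : ℝ≥0∞) :
      ∏ i, (if R i then y else 1) = y ^ cnt n R := by
    rw [Finset.prod_ite, Finset.prod_const, Finset.prod_const_one, mul_one, cnt,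
      Nat.card_eq_fintype_card, Fintype.card_subtype]
  calc (1 : ℝ≥0∞) = x⁻¹ ^ cnt n P * x ^ cnt n P := by
        rw [← mul_pow, ENNReal.inv_mul_cancel hx0 hxt, one_pow]
    _ ≤ x⁻¹ ^ cnt n P * x ^ cnt n Q := by gcongr
    _ = ∏ i, (if P i then x⁻¹ else 1) * (if Q i then x else 1) := by
        rw [Finset.prod_mul_distrib, hcard, hcard]
    _ ≤ ∏ i, f i := by
        refine Finset.prod_le_prod' fun i _ => ?_
        by_cases hp : P i
        · simpa [hp, hPQ i hp] using hP i hp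
        · by_cases hq : Q i
          · simpa [hp, hq] using hQ i hq
          · simpa [hp, hq] using h1 i hp

/-- **Fubini's theorem** for the product of the same function of each coordinate. -/
theorem lintegral_pi_prod_eq_pow {ι α : Type*} [Fintype ι] [MeasurableSpace α]
    (μ : Measure α) [IsProbabilityMeasure μ] {f : α → ℝ≥0∞} (hf : Measurable f) :
    ∫⁻ s : ι → α, ∏ i, f (s i) ∂(Measure.pi fun _ => μ) = (∫⁻ z, f z ∂μ) ^ Fintype.card ι := by
  have hind : ProbabilityTheory.iIndepFun (fun (i : ι) (s : ι → α) => f (s i))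
      (Measure.pi fun _ => μ) :=
    ProbabilityTheory.iIndepFun_pi (X := fun _ => f) fun _ => hf.aemeasurable
  have heval (i : ι) : ∫⁻ s : ι → α, f (s i) ∂(Measure.pi fun _ => μ) = ∫⁻ z, f z ∂μ :=
    (measurePreserving_eval (fun _ : ι => μ) i).lintegral_comp hf
  rw [ProbabilityTheory.lintegral_prod_eq_prod_lintegral_of_indepFun Finset.univ _ hind
    fun i => hf.comp (measurable_pi_apply i)]
  simp [heval]

/-- If `q = P^X(I) > 0` and `p = π(I × {1})/q > 1/2`, then the
probability that the label `-1` wins the majority vote on `I` among an i.i.d.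
sample of size `n` is at most `(1 - q(1 - exp(-2(p - 1/2)²)))^n`. -/
theorem majority_vote_error_bound (d : ℕ) (hd : 1 ≤ d) (n : ℕ) (hn : 1 ≤ n)
    (π : Measure (Pt d × ℝ)) [IsProbabilityMeasure π]
    (I : Set (Pt d)) (hI : MeasurableSet I)
    (q : ℝ) (hq : 0 < q) (hqdef : margX π I = ENNReal.ofReal q)
    (p : ℝ) (hp : 1 / 2 < p)
    (hpdef : π (I ×ˢ {(1 : ℝ)}) = ENNReal.ofReal p * margX π I) :
    sampM π n {s | cnt n (fun i => (s i).1 ∈ I ∧ (s i).2 = 1) ≤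
        cnt n (fun i => (s i).1 ∈ I ∧ (s i).2 = -1)} ≤
      ENNReal.ofReal ((1 - q * (1 - Real.exp (-2 * (p - 1 / 2) ^ 2))) ^ n) := by
  have hm : margX π I = π (I ×ˢ univ) := by
    rw [margX, Measure.map_apply measurable_fst hI, prod_univ]
  have hIu : MeasurableSet (I ×ˢ (univ : Set ℝ)) := hI.prod .univ
  have hI1 : MeasurableSet (I ×ˢ ({1} : Set ℝ)) := hI.prod (measurableSet_singleton 1)
  have hI2 : MeasurableSet (I ×ˢ ({1}ᶜ : Set ℝ)) := hI.prod (measurableSet_singleton 1).compl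
  have hp0 : 0 < p := by linarith
  rw [hqdef, ← ENNReal.ofReal_mul hp0.le] at hpdef
  rw [hqdef] at hm
  have hq1 : q ≤ 1 := by
    have h : ENNReal.ofReal q ≤ 1 := hm ▸ prob_le_one
    simpa using h
  have hp1 : p ≤ 1 := by
    have h : ENNReal.ofReal (p * q) ≤ ENNReal.ofReal q := by
      rw [← hpdef, hm]
      exact measure_mono (prod_mono_right (subset_univ _))
    rw [ENNReal.ofReal_le_ofReal_iff hq.le] at h
    nlinarith
  have hcompl : π (I ×ˢ univ)ᶜ = ENNReal.ofReal (1 - q) := by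
    rw [prob_compl_eq_one_sub hIu, ← hm, ENNReal.ofReal_sub _ hq.le, ENNReal.ofReal_one]
  have hneg : π (I ×ˢ ({1}ᶜ : Set ℝ)) = ENNReal.ofReal (q - p * q) := by
    have h : I ×ˢ ({1}ᶜ : Set ℝ) = I ×ˢ univ \ I ×ˢ {1} := by
      rw [prod_sdiff_prod, sdiff_self, empty_prod, union_empty, compl_eq_univ_sdiff]
    rw [h, measure_sdiff (prod_mono_right (subset_univ _)) hI1.nullMeasurableSet
      (measure_ne_top _ _), ← hm, hpdef, ENNReal.ofReal_sub _ (by positivity)]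
  obtain ⟨x, hx1, hx⟩ := exists_one_le_div_add_mul_le_exp hp hp1
  have hx0 : 0 < x := by linarith
  let f : Pt d × ℝ → ℝ≥0∞ := fun z =>
    (I ×ˢ (univ : Set ℝ))ᶜ.indicator (fun _ => 1) z
      + ((I ×ˢ ({1} : Set ℝ)).indicator (fun _ => (ENNReal.ofReal x)⁻¹) z
      + (I ×ˢ ({1}ᶜ : Set ℝ)).indicator (fun _ => ENNReal.ofReal x) z)
  have hf : Measurable f := (measurable_const.indicator hIu.compl).add
    ((measurable_const.indicator hI1).add (measurable_const.indicator hI2))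
  have hfint : ∫⁻ z, f z ∂π ≤
      ENNReal.ofReal (1 - q * (1 - Real.exp (-2 * (p - 1 / 2) ^ 2))) := by
    rw [lintegral_add_left (measurable_const.indicator hIu.compl),
      lintegral_add_left (measurable_const.indicator hI1),
      lintegral_indicator_const hIu.compl, lintegral_indicator_const hI1,
      lintegral_indicator_const hI2, hcompl, hpdef, hneg, one_mul,
      ← ENNReal.ofReal_inv_of_pos hx0, ← ENNReal.ofReal_mul (by positivity),
      ← ENNReal.ofReal_mul (by positivity),
      ← ENNReal.ofReal_add (by positivity) (mul_nonneg hx0.le (by nlinarith)),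
      ← ENNReal.ofReal_add (by linarith)
        (add_nonneg (by positivity) (mul_nonneg hx0.le (by nlinarith)))]
    refine ENNReal.ofReal_le_ofReal ?_
    have := mul_le_mul_of_nonneg_left hx hq.le
    linarith
  have hsub : {s : Fin n → Pt d × ℝ | cnt n (fun i => (s i).1 ∈ I ∧ (s i).2 = 1) ≤
      cnt n (fun i => (s i).1 ∈ I ∧ (s i).2 = -1)} ⊆ {s | 1 ≤ ∏ i, f (s i)} := by
    intro s hs
    have hx1' : 1 ≤ ENNReal.ofReal x := by simpa using hx1
    refine one_le_prod_of_cnt_le hx1' ENNReal.ofReal_ne_top ?_ ?_ ?_ ?_ hs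
    · rintro i ⟨h1, h2⟩
      simp [f, h1, h2]
    · rintro i ⟨h1, h2⟩
      have h3 : (-1 : ℝ) ≠ 1 := by norm_num
      simp [f, h1, h2, h3]
    · intro i h
      by_cases h1 : (s i).1 ∈ I
      · have h2 : (s i).2 ≠ 1 := fun h2 => h ⟨h1, h2⟩
        simpa [f, h1, h2] using hx1
      · simp [f, h1]
    · rintro i ⟨-, h1⟩ ⟨-, h2⟩
      norm_num [h1] at h2
  have hmarkov := mul_meas_ge_le_lintegral (μ := sampM π n)
    (f := fun s : Fin n → Pt d × ℝ => ∏ i, f (s i)) (by fun_prop) 1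
  rw [one_mul] at hmarkov
  refine (measure_mono hsub).trans (hmarkov.trans ?_)
  have hprod : ∫⁻ s, ∏ i, f (s i) ∂(sampM π n) = (∫⁻ z, f z ∂π) ^ n := by
    rw [sampM, lintegral_pi_prod_eq_pow π hf, Fintype.card_fin]
  rw [hprod, ENNReal.ofReal_pow]
  · gcongr
  · nlinarith [Real.exp_pos (-2 * (p - 1 / 2) ^ 2)]
end
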